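/- Let m = x_{i_1}⋯x_{i_s} be a square-free monomial in S = K[x_1,…,x_n] with i_1 < ⋯ < i_s ≤ n, with T(m) = (t_0,…,t_k) and IT(m) = (i_{t_0},…,i_{t_k}), and let I = sfBorel(m). If t_0 ≤ i_{t_k}, then ᾱ(I) = 1 + (s − 1)/(i_{t_k} − t_k + 1). -/

import Mathlib

open MvPolynomial

namespace SFB

/-- `B` is obtained from `A` by a single Borel move, where `A`, `B` are the
(1-based) supports of square-free monomials: some index `i ∈ A` is replaced
by an index `j` with `1 ≤ j < i` not already in `A`. -/
def BorelMove (A B : Finset ℕ) : Prop :=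
  ∃ i ∈ A, ∃ j, 1 ≤ j ∧ j < i ∧ j ∉ A ∧ B = insert j (A.erase i)

/-- `B` is obtained from `A` by finitely many Borel moves (possibly none). -/
def BorelReach (A B : Finset ℕ) : Prop :=
  Relation.ReflTransGen BorelMove A B

/-- The square-free monomial `∏_{r ∈ A} x_r` in `K[x_1,…,x_n]`,
where the variable `x_r` (for `1 ≤ r ≤ n`) is `X ⟨r-1,_⟩`. -/
noncomputable def sqfMon (K : Type*) [Field K] (n : ℕ) (A : Finset ℕ) :
    MvPolynomial (Fin n) K :=
  ∏ j : Fin n, if (j : ℕ) + 1 ∈ A then X j else 1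

/-- The square-free principal Borel ideal generated by the square-free
monomial with (1-based) support `A`, inside `K[x_1,…,x_n]`. -/
noncomputable def sfBorel (K : Type*) [Field K] (n : ℕ) (A : Finset ℕ) :
    Ideal (MvPolynomial (Fin n) K) :=
  Ideal.span {f | ∃ B, BorelReach A B ∧ f = sqfMon K n B}

/-- `α(J)`: the least degree of a nonzero homogeneous element of `J`. -/
noncomputable def alpha {K : Type*} [Field K] {n : ℕ}
    (J : Ideal (MvPolynomial (Fin n) K)) : ℕ :=
  sInf {d | ∃ f ∈ J, f ≠ 0 ∧ MvPolynomial.IsHomogeneous f d}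

/-- The `s`-th symbolic power of `I`: the intersection of the `s`-th powers
of the minimal primes of `I`. -/
noncomputable def symbPow {R : Type*} [CommRing R] (I : Ideal R) (s : ℕ) :
    Ideal R :=
  ⨅ P ∈ I.minimalPrimes, P ^ s

/-- The Waldschmidt constant `ᾱ(I) = inf_{s ≥ 1} α(I^{(s)})/s`
(which equals `lim_{s→∞} α(I^{(s)})/s`). -/
noncomputable def waldschmidt {K : Type*} [Field K] {n : ℕ}
    (I : Ideal (MvPolynomial (Fin n) K)) : ℝ :=
  ⨅ s : ℕ+, (alpha (symbPow I (s : ℕ)) : ℝ) / ((s : ℕ) : ℝ)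

/-- `t 0, t 1, …, t k` is the sequence `T(m)` associated to the square-free
monomial `m = x_{i 1} ⋯ x_{i s}` (with `i` strictly increasing on `1,…,s`):
`t 0 = s`, and for `1 ≤ j ≤ k`, `t j = max { r < t (j-1) | i r < i (r+1) - 1 }`,
with `k` the last index for which this maximum exists. -/
def IsTSeq (s : ℕ) (i : ℕ → ℕ) (t : ℕ → ℕ) (k : ℕ) : Prop :=
  t 0 = s ∧
  (∀ j, 1 ≤ j → j ≤ k →
    1 ≤ t j ∧ t j < t (j - 1) ∧ i (t j) + 1 < i (t j + 1) ∧
    ∀ r, t j < r → r < t (j - 1) → ¬ (i r + 1 < i (r + 1))) ∧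
  (∀ r, 1 ≤ r → r < t k → ¬ (i r + 1 < i (r + 1)))

end SFB

namespace SFB

lemma incr (s : ℕ) (i : ℕ → ℕ) (hmono : ∀ r, 1 ≤ r → r < s → i r < i (r + 1))
    (r d : ℕ) (hr : 1 ≤ r) (hd : r + d ≤ s) : i r + d ≤ i (r + d) := by
  induction d with
  | zero => simp
  | succ d ih =>
    have := ih (by omega)
    have h2 := hmono (r + d) (by omega) (by omega)
    rw [← add_assoc r d 1]
    omega

lemma incr_lt (s : ℕ) (i : ℕ → ℕ) (hmono : ∀ r, 1 ≤ r → r < s → i r < i (r + 1))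
    (r r' : ℕ) (hr : 1 ≤ r) (h : r < r') (hd : r' ≤ s) : i r < i r' := by
  obtain ⟨d, rfl⟩ := Nat.exists_eq_add_of_lt h
  have := incr s i hmono r (d + 1) hr (by omega)
  rw [← add_assoc r d 1] at this
  omega

lemma avg {ι : Type*} [DecidableEq ι] (F : Finset ι) (b : ι → ℕ) (d : ℕ) :
    ∀ u, u + d = F.card →
      ∃ U ⊆ F, U.card = u ∧ u * ∑ x ∈ F, b x ≤ F.card * ∑ x ∈ U, b x := by
  induction d with
  | zero =>
    intro u hu
    exact ⟨F, subset_rfl, by omega, by rw [← hu]; simp⟩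
  | succ d ih =>
    intro u hu
    obtain ⟨U, hUF, hUc, hU⟩ := ih (u + 1) (by omega)
    obtain ⟨x, hx, hmin⟩ := Finset.exists_min_image U b (Finset.card_pos.1 (by omega))
    have hc : (U.erase x).card = u := by rw [Finset.card_erase_of_mem hx]; omega
    refine ⟨U.erase x, (Finset.erase_subset _ _).trans hUF, hc, ?_⟩
    have h1 : ∑ y ∈ U.erase x, b y + b x = ∑ y ∈ U, b y := Finset.sum_erase_add _ _ hx
    have h2 : u * b x ≤ ∑ y ∈ U.erase x, b y := by
      rw [← hc, ← smul_eq_mul]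
      exact Finset.card_nsmul_le_sum _ _ _ (fun y hy => hmin y (Finset.mem_of_mem_erase hy))
    rw [← h1] at hU
    generalize ∑ y ∈ U.erase x, b y = A at *
    generalize ∑ y ∈ F, b y = T at *
    generalize F.card = N at *
    generalize b x = c at *
    have h3 : (u + 1) * (u * T) ≤ (u + 1) * (N * A) := by
      calc (u + 1) * (u * T) = u * ((u + 1) * T) := by ring
        _ ≤ u * (N * (A + c)) := Nat.mul_le_mul_left _ hU
        _ = N * (u * A + u * c) := by ring
        _ ≤ N * (u * A + A) := by gcongr
        _ = _ := by ring
    exact Nat.le_of_mul_le_mul_left h3 (by omega)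

/-- Combination of the two averaging bounds. -/
lemma avg2 {ι : Type*} [DecidableEq ι] (F : Finset ι) (b : ι → ℕ) (p u q : ℕ)
    (hp : 1 ≤ p) (hpF : p ≤ F.card) (hu : u ≤ F.card)
    (hC : ∀ C ⊆ F, C.card = p → q ≤ ∑ x ∈ C, b x) :
    ∃ U ⊆ F, U.card = u ∧ u * q ≤ p * ∑ x ∈ U, b x := by
  obtain ⟨U, hUF, hUc, hU⟩ := avg F b (F.card - u) u (by omega)
  obtain ⟨V, hVF, hVc, hV⟩ := avg F b p (F.card - p) (by omega)
  refine ⟨U, hUF, hUc, ?_⟩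
  have h1 := hC (F \ V) Finset.sdiff_subset (by rw [Finset.card_sdiff_of_subset hVF]; omega)
  have h2 : ∑ x ∈ F \ V, b x + ∑ x ∈ V, b x = ∑ x ∈ F, b x := Finset.sum_sdiff hVF
  obtain ⟨e, he⟩ := Nat.exists_eq_add_of_le hpF
  have h3 : F.card - p = e := by omega
  rw [h3] at hV
  have hN : 0 < F.card := by omega
  have h4 : F.card * q ≤ p * ∑ x ∈ F, b x := by
    have : F.card * q ≤ F.card * ∑ x ∈ F \ V, b x := Nat.mul_le_mul_left _ h1
    have h5 : F.card * ∑ x ∈ F \ V, b x + F.card * ∑ x ∈ V, b x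
        = (p + e) * ∑ x ∈ F, b x := by rw [← mul_add, h2, he]
    rw [add_mul] at h5
    omega
  apply Nat.le_of_mul_le_mul_left _ hN
  calc F.card * (u * q) = u * (F.card * q) := by ring
    _ ≤ u * (p * ∑ x ∈ F, b x) := Nat.mul_le_mul_left _ h4
    _ = p * (u * ∑ x ∈ F, b x) := by ring
    _ ≤ p * (F.card * ∑ x ∈ U, b x) := Nat.mul_le_mul_left _ hU
    _ = _ := by ring

lemma reach_of_le (s : ℕ) (i j : ℕ → ℕ)
    (hi : ∀ r, 1 ≤ r → r < s → i r < i (r + 1))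
    (hj : ∀ r, 1 ≤ r → r < s → j r < j (r + 1))
    (hj1 : 1 ≤ j 1) (hle : ∀ r, 1 ≤ r → r ≤ s → j r ≤ i r) :
    BorelReach ((Finset.Icc 1 s).image i) ((Finset.Icc 1 s).image j) := by
  have key : ∀ d, d ≤ s → BorelReach ((Finset.Icc 1 s).image i)
      ((Finset.Icc 1 s).image (fun r => if r ≤ d then j r else i r)) := by
    intro d
    induction d with
    | zero =>
      intro _
      have : (Finset.Icc 1 s).image (fun r => if r ≤ 0 then j r else i r)
          = (Finset.Icc 1 s).image i := by
        apply Finset.image_congr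
        intro r hr
        simp at hr
        have : ¬ r = 0 := by omega
        simp [this]
      rw [this]
      exact Relation.ReflTransGen.refl
    | succ d ih =>
      intro hd
      have ih := ih (by omega)
      rcases (hle (d + 1) (by omega) hd).eq_or_lt with heq | hlt
      · have : (Finset.Icc 1 s).image (fun r => if r ≤ d + 1 then j r else i r)
          = (Finset.Icc 1 s).image (fun r => if r ≤ d then j r else i r) := by
          apply Finset.image_congr
          intro r hr
          by_cases h : r = d + 1
          · subst h; simp [heq]
          · have : r ≤ d + 1 ↔ r ≤ d := by omega
            simp only [this]
        rw [this]
        exact ih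
      · refine ih.tail ⟨i (d + 1), ?_, j (d + 1), ?_, hlt, ?_, ?_⟩
        · simp only [Finset.mem_image, Finset.mem_Icc]
          exact ⟨d + 1, by omega, by simp⟩
        · have := incr s j hj 1 d le_rfl (by omega)
          rw [add_comm 1 d] at this
          omega
        · simp only [Finset.mem_image, Finset.mem_Icc, not_exists, not_and]
          rintro r ⟨hr1, hr2⟩ h
          split_ifs at h with hrd
          · have := incr_lt s j hj r (d + 1) hr1 (by omega) hd
            omega
          · rcases Nat.eq_or_lt_of_le (show d + 1 ≤ r by omega) with h' | h'
            · subst h'; omega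
            · have := incr_lt s i hi (d + 1) r (by omega) h' hr2
              omega
        · ext x
          simp only [Finset.mem_image, Finset.mem_Icc, Finset.mem_insert, Finset.mem_erase]
          constructor
          · rintro ⟨r, ⟨hr1, hr2⟩, rfl⟩
            by_cases h : r = d + 1
            · subst h; simp
            · right
              have h' : r ≤ d + 1 ↔ r ≤ d := by omega
              simp only [h']
              refine ⟨?_, r, ⟨hr1, hr2⟩, rfl⟩
              split_ifs with hrd
              · have := incr_lt s j hj r (d + 1) hr1 (by omega) hd
                omega
              · have := incr_lt s i hi (d + 1) r (by omega) (by omega) hr2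
                omega
          · rintro (rfl | ⟨hne, r, ⟨hr1, hr2⟩, rfl⟩)
            · exact ⟨d + 1, by omega, by simp⟩
            · refine ⟨r, ⟨hr1, hr2⟩, ?_⟩
              by_cases h : r = d + 1
              · subst h; simp at hne
              · have h' : r ≤ d + 1 ↔ r ≤ d := by omega
                simp only [h']
  have := key s le_rfl
  have h2 : (Finset.Icc 1 s).image (fun r => if r ≤ s then j r else i r)
      = (Finset.Icc 1 s).image j := by
    apply Finset.image_congr
    intro r hr
    simp at hr
    simp [hr.2]
  rwa [h2] at this

lemma reach_card (A B : Finset ℕ) (hAB : BorelReach A B) (N : ℕ) :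
    (∀ x ∈ A, 1 ≤ x) → (∀ x ∈ B, 1 ≤ x) ∧
      (A.filter (· ≤ N)).card ≤ (B.filter (· ≤ N)).card := by
  intro hA
  induction hAB with
  | refl => exact ⟨hA, le_rfl⟩
  | tail _ hm ih =>
    rename_i B D _
    obtain ⟨i, hi, j, hj1, hji, hjB, rfl⟩ := hm
    constructor
    · intro x hx
      rcases Finset.mem_insert.1 hx with rfl | hx
      · exact hj1
      · exact ih.1 x (Finset.mem_of_mem_erase hx)
    · refine ih.2.trans ?_
      rw [Finset.filter_insert, Finset.filter_erase]
      split_ifs with h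
      · rw [Finset.card_insert_of_notMem (by simp [hjB])]
        have := Finset.pred_card_le_card_erase (s := B.filter (· ≤ N)) (a := i)
        omega
      · rw [Finset.erase_eq_of_notMem]
        simp; intro; omega

variable {K : Type*} [Field K] {n : ℕ}

/-- The grading hom: `x_j ↦ T x_j` for `j ∈ C`. -/
noncomputable def gr (K : Type*) [Field K] {n : ℕ} (C : Finset (Fin n)) :
    MvPolynomial (Fin n) K →+* Polynomial (MvPolynomial (Fin n) K) :=
  eval₂Hom (Polynomial.C.comp MvPolynomial.C)
    (fun j => if j ∈ C then Polynomial.X * Polynomial.C (X j) else Polynomial.C (X j))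

lemma gr_monomial (C : Finset (Fin n)) (a : Fin n →₀ ℕ) (c : K) :
    gr K C (monomial a c) = Polynomial.C (monomial a c) * Polynomial.X ^ (∑ j ∈ C, a j) := by
  rw [gr, eval₂Hom_monomial, Finsupp.prod_fintype _ _ (by simp)]
  have : ∀ j : Fin n, (if j ∈ C then Polynomial.X * Polynomial.C (X j) else
      Polynomial.C (X j : MvPolynomial (Fin n) K)) ^ (a j)
      = Polynomial.C (X j ^ a j) * (if j ∈ C then Polynomial.X ^ a j else 1) := by
    intro j
    split_ifs
    · rw [mul_pow, mul_comm, map_pow]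
    · simp
  rw [Finset.prod_congr rfl (fun j _ => this j), Finset.prod_mul_distrib,
    Finset.prod_ite_mem, Finset.univ_inter, Finset.prod_pow_eq_pow_sum, ← mul_assoc]
  congr 1
  rw [monomial_eq, Finsupp.prod_fintype _ _ (by simp), map_mul, map_prod]
  rfl

lemma gr_coeff (C : Finset (Fin n)) (f : MvPolynomial (Fin n) K) (a : Fin n →₀ ℕ) (k : ℕ) :
    coeff a ((gr K C f).coeff k) = if ∑ j ∈ C, a j = k then coeff a f else 0 := by
  induction f using MvPolynomial.induction_on' with
  | monomial u c =>
    rw [gr_monomial, Polynomial.coeff_C_mul, Polynomial.coeff_X_pow]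
    by_cases h : u = a
    · subst h
      split_ifs <;> simp_all
    · split_ifs <;> simp [coeff_monomial, h]
  | add p q hp hq =>
    rw [map_add, Polynomial.coeff_add, coeff_add, hp, hq]
    split_ifs <;> simp

/-- The prime ideal generated by the variables in `C`. -/
noncomputable def PC (K : Type*) [Field K] {n : ℕ} (C : Finset (Fin n)) :
    Ideal (MvPolynomial (Fin n) K) :=
  (Ideal.span {Polynomial.X}).comap (gr K C)

instance PC_prime (C : Finset (Fin n)) : (PC K C).IsPrime := by
  haveI : (Ideal.span {(Polynomial.X : Polynomial (MvPolynomial (Fin n) K))}).IsPrime :=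
    (Ideal.span_singleton_prime Polynomial.X_ne_zero).2 Polynomial.prime_X
  exact Ideal.comap_isPrime _ _

lemma X_mem_PC (C : Finset (Fin n)) (j : Fin n) (hj : j ∈ C) :
    (X j : MvPolynomial (Fin n) K) ∈ PC K C := by
  rw [PC, Ideal.mem_comap, Ideal.mem_span_singleton, gr]
  simp [hj]

lemma mem_PC_pow (C : Finset (Fin n)) (q : ℕ) (f : MvPolynomial (Fin n) K)
    (hf : f ∈ PC K C ^ q) (a : Fin n →₀ ℕ) (ha : coeff a f ≠ 0) : q ≤ ∑ j ∈ C, a j := by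
  have h1 : gr K C f ∈ Ideal.span {(Polynomial.X : Polynomial (MvPolynomial (Fin n) K))} ^ q :=
    Ideal.le_comap_pow _ _ hf
  rw [Ideal.span_singleton_pow, Ideal.mem_span_singleton, Polynomial.X_pow_dvd_iff] at h1
  by_contra hlt
  have h2 := h1 _ (not_le.1 hlt)
  have h3 := gr_coeff C f a (∑ j ∈ C, a j)
  rw [h2] at h3
  simp at h3
  exact ha h3.symm

lemma sqfMon_mem_of (P : Ideal (MvPolynomial (Fin n) K)) (B : Finset ℕ) (j : Fin n)
    (hj : (j : ℕ) + 1 ∈ B) (hX : X j ∈ P) : sqfMon K n B ∈ P := by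
  rw [sqfMon, ← Finset.mul_prod_erase _ _ (Finset.mem_univ j), if_pos hj]
  exact Ideal.mul_mem_right _ _ hX

lemma exists_of_sqfMon_mem (P : Ideal (MvPolynomial (Fin n) K)) [P.IsPrime] (B : Finset ℕ)
    (h : sqfMon K n B ∈ P) : ∃ j : Fin n, (j : ℕ) + 1 ∈ B ∧ X j ∈ P := by
  rw [sqfMon, Ideal.IsPrime.prod_mem_iff] at h
  obtain ⟨j, -, hj⟩ := h
  split_ifs at hj with hjB
  · exact ⟨j, hjB, hj⟩
  · exact absurd ((Ideal.eq_top_iff_one _).2 hj) (Ideal.IsPrime.ne_top inferInstance)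

lemma sqfMon_ne_zero (B : Finset ℕ) : sqfMon K n B ≠ 0 := by
  rw [sqfMon, Finset.prod_ne_zero_iff]
  intro j _
  split_ifs
  · exact X_ne_zero j
  · exact one_ne_zero

lemma sqfMon_homog (B : Finset ℕ) :
    (sqfMon K n B).IsHomogeneous (∑ j : Fin n, if (j : ℕ) + 1 ∈ B then 1 else 0) := by
  apply IsHomogeneous.prod
  intro j _
  split_ifs
  · exact isHomogeneous_X _ _
  · exact isHomogeneous_one _ _

lemma card_filter_fin (N : ℕ) (hN : N ≤ n) :
    (Finset.univ.filter (fun j : Fin n => (j : ℕ) + 1 ≤ N)).card = N := by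
  have : ((Finset.univ.filter (fun j : Fin n => (j : ℕ) + 1 ≤ N)).image
      (fun j : Fin n => (j : ℕ))) = Finset.range N := by
    ext x
    simp only [Finset.mem_image, Finset.mem_filter, Finset.mem_univ, true_and, Finset.mem_range]
    constructor
    · rintro ⟨j, hj, rfl⟩; omega
    · intro hx; exact ⟨⟨x, by omega⟩, by simpa using hx, rfl⟩
  have h2 := congrArg Finset.card this
  rwa [Finset.card_image_of_injective _ Fin.val_injective, Finset.card_range] at h2

section main
variable (s : ℕ) (i : ℕ → ℕ) (hs : 1 ≤ s)
    (hmono : ∀ r, 1 ≤ r → r < s → i r < i (r + 1))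
    (h1 : 1 ≤ i 1) (hn : i s ≤ n)

lemma sfBorel_le_PC (s : ℕ) (i : ℕ → ℕ)
    (hmono : ∀ r, 1 ≤ r → r < s → i r < i (r + 1)) (h1 : 1 ≤ i 1)
    (r : ℕ) (hr1 : 1 ≤ r) (hr : r ≤ s) (C : Finset (Fin n))
    (hC : ∀ j ∈ C, (j : ℕ) + 1 ≤ i r) (hcard : i r + 1 ≤ C.card + r) :
    sfBorel K n ((Finset.Icc 1 s).image i) ≤ PC K C := by
  rw [sfBorel, Ideal.span_le]
  rintro f ⟨B, hB, rfl⟩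
  have hpos : ∀ x ∈ (Finset.Icc 1 s).image i, 1 ≤ x := by
    intro x hx
    simp only [Finset.mem_image, Finset.mem_Icc] at hx
    obtain ⟨r', ⟨h, h'⟩, rfl⟩ := hx
    have := incr s i hmono 1 (r' - 1) le_rfl (by omega)
    rw [show 1 + (r' - 1) = r' by omega] at this
    omega
  obtain ⟨hB1, hB2⟩ := reach_card _ _ hB (i r) hpos
  have hrA : r ≤ (((Finset.Icc 1 s).image i).filter (· ≤ i r)).card := by
    have hsub : (Finset.Icc 1 r).image i ⊆ ((Finset.Icc 1 s).image i).filter (· ≤ i r) := by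
      intro x hx
      simp only [Finset.mem_image, Finset.mem_Icc, Finset.mem_filter] at hx ⊢
      obtain ⟨r', ⟨h, h'⟩, rfl⟩ := hx
      refine ⟨⟨r', by omega, rfl⟩, ?_⟩
      have := incr s i hmono r' (r - r') h (by omega)
      rw [show r' + (r - r') = r by omega] at this
      omega
    have hinj : Set.InjOn i (Finset.Icc 1 r : Finset ℕ) := by
      intro x hx y hy hxy
      simp at hx hy
      rcases lt_trichotomy x y with h | h | h
      · have := incr_lt s i hmono x y (by omega) h (by omega); omega
      · exact h
      · have := incr_lt s i hmono y x (by omega) h (by omega); omega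
    have := Finset.card_le_card hsub
    rw [Finset.card_image_of_injOn hinj] at this
    simpa using this
  have hinj2 : Function.Injective (fun j : Fin n => (j : ℕ) + 1) := by
    intro x y hxy
    simp at hxy
    omega
  by_cases hdis : Disjoint (B.filter (· ≤ i r)) (C.image (fun j : Fin n => (j : ℕ) + 1))
  · exfalso
    have hsub : B.filter (· ≤ i r) ∪ C.image (fun j : Fin n => (j : ℕ) + 1)
        ⊆ Finset.Icc 1 (i r) := by
      intro x hx
      rcases Finset.mem_union.1 hx with hx | hx
      · simp only [Finset.mem_filter] at hx
        exact Finset.mem_Icc.2 ⟨hB1 x hx.1, hx.2⟩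
      · obtain ⟨j, hj, rfl⟩ := Finset.mem_image.1 hx
        exact Finset.mem_Icc.2 ⟨by omega, hC j hj⟩
    have := Finset.card_le_card hsub
    rw [Finset.card_union_of_disjoint hdis, Finset.card_image_of_injective _ hinj2] at this
    simp at this
    omega
  · obtain ⟨x, hx, hx'⟩ := Finset.not_disjoint_iff.1 hdis
    obtain ⟨j, hj, rfl⟩ := Finset.mem_image.1 hx'
    exact sqfMon_mem_of _ _ j (Finset.mem_filter.1 hx).1 (X_mem_PC C j hj)

lemma le_sum_of_mem_symbPow (s : ℕ) (i : ℕ → ℕ)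
    (hmono : ∀ r, 1 ≤ r → r < s → i r < i (r + 1)) (h1 : 1 ≤ i 1)
    (r : ℕ) (hr1 : 1 ≤ r) (hr : r ≤ s) (C : Finset (Fin n))
    (hC : ∀ j ∈ C, (j : ℕ) + 1 ≤ i r) (hcard : i r + 1 ≤ C.card + r)
    (q : ℕ) (f : MvPolynomial (Fin n) K)
    (hf : f ∈ symbPow (sfBorel K n ((Finset.Icc 1 s).image i)) q)
    (a : Fin n →₀ ℕ) (ha : coeff a f ≠ 0) : q ≤ ∑ j ∈ C, a j := by
  obtain ⟨P, hP, hPle⟩ := Ideal.exists_minimalPrimes_le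
    (sfBorel_le_PC (K := K) s i hmono h1 r hr1 hr C hC hcard)
  apply mem_PC_pow C q f _ a ha
  simp only [symbPow, Ideal.mem_iInf] at hf
  exact Ideal.pow_right_mono hPle q (hf P hP)

lemma sfBorel_self (A : Finset ℕ) : sqfMon K n A ∈ sfBorel K n A :=
  Ideal.subset_span ⟨A, Relation.ReflTransGen.refl, rfl⟩

lemma alpha_spec (A : Finset ℕ) (q : ℕ) :
    ∃ f ∈ symbPow (sfBorel K n A) q, f ≠ 0 ∧
      f.IsHomogeneous (alpha (symbPow (sfBorel K n A) q)) := by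
  apply Nat.sInf_mem (s := {d | ∃ f ∈ symbPow (sfBorel K n A) q, f ≠ 0 ∧ f.IsHomogeneous d})
  refine ⟨_, sqfMon K n A ^ q, ?_, pow_ne_zero _ (sqfMon_ne_zero A), (sqfMon_homog A).pow q⟩
  simp only [symbPow, Ideal.mem_iInf]
  intro P hP
  exact Ideal.pow_mem_pow (hP.1.2 (sfBorel_self A)) q

lemma upper (s : ℕ) (i : ℕ → ℕ) (hs : 1 ≤ s)
    (hmono : ∀ r, 1 ≤ r → r < s → i r < i (r + 1))
    (h1 : 1 ≤ i 1) (hn : i s ≤ n) :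
    alpha (symbPow (sfBorel K n ((Finset.Icc 1 s).image i)) (i 1)) ≤ i 1 + s - 1 := by
  have his := incr s i hmono 1 (s - 1) le_rfl (by omega)
  rw [show 1 + (s - 1) = s by omega] at his
  set M := i 1 + s - 1 with hM
  set F := Finset.univ.filter (fun j : Fin n => (j : ℕ) + 1 ≤ M) with hF
  have hFc : F.card = M := card_filter_fin M (by omega)
  apply Nat.sInf_le
  refine ⟨∏ j ∈ F, X j, ?_, ?_, ?_⟩
  · simp only [symbPow, Ideal.mem_iInf]
    intro P hP
    haveI : P.IsPrime := hP.1.1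
    classical
    have hcard : i 1 ≤ (F.filter (fun j => X j ∈ P)).card := by
      by_contra hlt
      have hsum := Finset.card_filter_add_card_filter_not (s := F)
        (fun j => (X j : MvPolynomial (Fin n) K) ∈ P)
      have hs' : s ≤ (F.filter (fun j => ¬ (X j : MvPolynomial (Fin n) K) ∈ P)).card := by omega
      obtain ⟨W, hW, hWc⟩ := Finset.exists_subset_card_eq hs'
      set e := W.orderEmbOfFin hWc with he
      let w : ℕ → ℕ := fun r => if h : r - 1 < s then (e ⟨r - 1, h⟩ : ℕ) + 1 else 0
      have hw : ∀ r (h : r - 1 < s), w r = (e ⟨r - 1, h⟩ : ℕ) + 1 := fun r h => by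
        simp [w, h]
      have hwm : ∀ r, 1 ≤ r → r < s → w r < w (r + 1) := by
        intro r hr hrs
        rw [hw r (by omega), hw (r + 1) (by omega)]
        have : e ⟨r - 1, by omega⟩ < e ⟨r + 1 - 1, by omega⟩ :=
          e.strictMono (by simp [Fin.lt_def]; omega)
        simpa [Fin.lt_def] using this
      have hmem : ∀ x, e x ∈ W := fun x => Finset.orderEmbOfFin_mem W hWc x
      have hws : w s ≤ M := by
        rw [hw s (by omega)]
        exact (Finset.mem_filter.1 (Finset.mem_filter.1 (hW (hmem _))).1).2
      have hreach : BorelReach ((Finset.Icc 1 s).image i) ((Finset.Icc 1 s).image w) := by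
        apply reach_of_le s i w hmono hwm
        · rw [hw 1 (by omega)]; omega
        · intro r hr hrs
          have a1 := incr s w hwm r (s - r) hr (by omega)
          rw [show r + (s - r) = s by omega] at a1
          have a2 := incr s i hmono 1 (r - 1) le_rfl (by omega)
          rw [show 1 + (r - 1) = r by omega] at a2
          omega
      have hin : sqfMon K n ((Finset.Icc 1 s).image w) ∈ P :=
        hP.1.2 (Ideal.subset_span ⟨_, hreach, rfl⟩)
      obtain ⟨j, hj, hjP⟩ := exists_of_sqfMon_mem P _ hin
      obtain ⟨r, hr, hrj⟩ := Finset.mem_image.1 hj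
      rw [Finset.mem_Icc] at hr
      rw [hw r (by omega)] at hrj
      have : e ⟨r - 1, by omega⟩ = j := Fin.ext (by omega)
      have hj' := (Finset.mem_filter.1 (hW (hmem ⟨r - 1, by omega⟩))).2
      rw [this] at hj'
      exact hj' hjP
    rw [← Finset.prod_filter_mul_prod_filter_not F (fun j => (X j : MvPolynomial (Fin n) K) ∈ P)]
    apply Ideal.mul_mem_right
    apply Ideal.pow_le_pow_right hcard
    have := Ideal.prod_mem_prod (s := F.filter (fun j => (X j : MvPolynomial (Fin n) K) ∈ P))
      (I := fun _ => P) (x := fun j => (X j : MvPolynomial (Fin n) K))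
      (fun j hj => (Finset.mem_filter.1 hj).2)
    simpa using this
  · rw [Finset.prod_ne_zero_iff]
    exact fun j _ => X_ne_zero j
  · have := IsHomogeneous.prod F (fun j => (X j : MvPolynomial (Fin n) K)) (fun _ => 1)
      (fun j _ => isHomogeneous_X _ _)
    simpa [hFc] using this

lemma lower (s : ℕ) (i : ℕ → ℕ)
    (hmono : ∀ r, 1 ≤ r → r < s → i r < i (r + 1))
    (h1 : 1 ≤ i 1) (hn : i s ≤ n) (t : ℕ) (ht1 : 1 ≤ t) (hts : t ≤ s)
    (hit : i t + 1 = i 1 + t) (hsi : s ≤ i t) (q : ℕ) :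
    (i 1 + s - 1) * q
      ≤ i 1 * alpha (symbPow (sfBorel K n ((Finset.Icc 1 s).image i)) q) := by
  obtain ⟨f, hf, hf0, hhom⟩ := alpha_spec (K := K) (n := n) ((Finset.Icc 1 s).image i) q
  generalize alpha (symbPow (sfBorel K n ((Finset.Icc 1 s).image i)) q) = d at *
  obtain ⟨a, ha⟩ := MvPolynomial.ne_zero_iff.1 hf0
  have hd : ∑ j, a j = d := by
    have := hhom ha
    rw [← this]
    simp [Finsupp.weight_apply, Finsupp.sum_fintype]
  have hits := incr s i hmono t (s - t) ht1 (by omega)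
  rw [show t + (s - t) = s by omega] at hits
  set F := Finset.univ.filter (fun j : Fin n => (j : ℕ) + 1 ≤ i t) with hF
  have hFc : F.card = i t := card_filter_fin _ (by omega)
  set G := Finset.univ.filter (fun j : Fin n => (j : ℕ) + 1 ≤ i s) with hG
  have hGc : G.card = i s := card_filter_fin _ (by omega)
  obtain ⟨U, hUF, hUc, hU⟩ := avg2 F a (i 1) (s - 1) q h1 (by omega) (by omega) (by
    intro C hC hCc
    exact le_sum_of_mem_symbPow s i hmono h1 t ht1 hts C
      (fun j hj => (Finset.mem_filter.1 (hC hj)).2) (by omega) q f hf a ha)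
  have hFG : F ⊆ G := by
    intro j hj
    simp only [hF, hG, Finset.mem_filter, Finset.mem_univ, true_and] at hj ⊢
    omega
  have hUG := hUF.trans hFG
  have h2 := le_sum_of_mem_symbPow s i hmono h1 s (by omega) le_rfl (G \ U)
      (fun j hj => (Finset.mem_filter.1 (Finset.mem_sdiff.1 hj).1).2)
      (by rw [Finset.card_sdiff_of_subset hUG]; omega) q f hf a ha
  have h3 : ∑ x ∈ G \ U, a x + ∑ x ∈ U, a x = ∑ x ∈ G, a x := Finset.sum_sdiff hUG
  have h4 : ∑ x ∈ G, a x ≤ ∑ x, a x :=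
    Finset.sum_le_sum_of_subset (Finset.subset_univ _)
  have h5 : q + ∑ x ∈ U, a x ≤ d := by omega
  calc (i 1 + s - 1) * q = i 1 * q + (s - 1) * q := by
        rw [← add_mul]; congr 1; omega
    _ ≤ i 1 * q + i 1 * ∑ x ∈ U, a x := by omega
    _ = i 1 * (q + ∑ x ∈ U, a x) := by ring
    _ ≤ _ := Nat.mul_le_mul_left _ h5

end main

lemma tseq_facts (s k : ℕ) (i t : ℕ → ℕ) (hs : 1 ≤ s)
    (hmono : ∀ r, 1 ≤ r → r < s → i r < i (r + 1)) (hT : IsTSeq s i t k) :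
    1 ≤ t k ∧ t k ≤ s ∧ i (t k) + 1 = i 1 + t k := by
  obtain ⟨h0, hst, hlast⟩ := hT
  have hle : ∀ j, j ≤ k → t j ≤ s := by
    intro j
    induction j with
    | zero => intro _; omega
    | succ j ih =>
      intro hj
      have := (hst (j + 1) (by omega) hj).2.1
      have := ih (by omega)
      simp at *
      omega
  have h1 : 1 ≤ t k := by
    rcases Nat.eq_zero_or_pos k with rfl | hk
    · omega
    · exact (hst k hk le_rfl).1
  have hk := hle k le_rfl
  refine ⟨h1, hk, ?_⟩
  have key : ∀ d, 1 + d ≤ t k → i (1 + d) = i 1 + d := by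
    intro d
    induction d with
    | zero => simp
    | succ d ih =>
      intro hd
      have e := ih (by omega)
      have := hlast (1 + d) (by omega) (by omega)
      have h3 := hmono (1 + d) (by omega) (by omega)
      rw [← add_assoc 1 d 1]
      omega
  have := key (t k - 1) (by omega)
  rw [show 1 + (t k - 1) = t k by omega] at this
  omega

end SFB

open SFB in
/-- Theorem 4.1: if `t 0 ≤ i (t k)`, then
`ᾱ(sfBorel(m)) = 1 + (s - 1)/(i_{t k} - t k + 1)`. -/
theorem statement6 (K : Type*) [Field K] (n s k : ℕ) (i t : ℕ → ℕ)
    (hs : 1 ≤ s)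
    (hmono : ∀ r, 1 ≤ r → r < s → i r < i (r + 1))
    (h1 : 1 ≤ i 1) (hn : i s ≤ n)
    (hT : IsTSeq s i t k)
    (h : t 0 ≤ i (t k)) :
    waldschmidt (sfBorel K n ((Finset.Icc 1 s).image i)) =
      1 + ((s : ℝ) - 1) / ((i (t k) : ℝ) - (t k : ℝ) + 1) := by
  have h0 : t 0 = s := hT.1
  obtain ⟨ht1, hts, hit⟩ := tseq_facts s k i t hs hmono hT
  have hlow := lower (K := K) s i hmono h1 hn (t k) ht1 hts hit (h0 ▸ h)
  have hup := upper (K := K) s i hs hmono h1 hn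
  have hp : (0 : ℝ) < i 1 := by exact_mod_cast h1
  have hden : (i (t k) : ℝ) - (t k : ℝ) + 1 = i 1 := by
    have : (i (t k) : ℝ) + 1 = i 1 + t k := by exact_mod_cast hit
    linarith
  have hnum : ((i 1 + s - 1 : ℕ) : ℝ) = i 1 + s - 1 := by
    rw [Nat.cast_sub (by omega)]; push_cast; ring
  have hval : 1 + ((s : ℝ) - 1) / i 1 = ((i 1 + s - 1 : ℕ) : ℝ) / i 1 := by
    rw [hnum]; field_simp; ring
  rw [hden, hval, waldschmidt]
  apply le_antisymm
  · refine (ciInf_le ⟨0, ?_⟩ (⟨i 1, h1⟩ : ℕ+)).trans ?_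
    · rintro _ ⟨q, rfl⟩
      positivity
    · simp only [PNat.mk_coe]
      gcongr
  · apply le_ciInf
    intro q
    have hq : (0 : ℝ) < ((q : ℕ) : ℝ) := by exact_mod_cast q.pos
    rw [div_le_div_iff₀ hp hq]
    have := hlow (q : ℕ)
    rw [mul_comm (i 1)] at this
    exact_mod_cast this
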